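/- For every monoid M, at least one of the following holds: (1) every language in VA(M) (over every finite alphabet) is semilinear; (2) for every finite alphabet X, every language over X in VA(ℤ) (the blind one-counter languages, ℤ being the multiplicatively written group of integers) lies in VA(M); (3) for every finite alphabet X, every language over X in VA(B) (the partially blind one-counter languages, B being the bicyclic monoid) lies in VA(M). -/

import Mathlib

namespace Paper

/-- Defining relation of the bicyclic monoid: the word `x·x̄` is identified with the
empty word. The generator `x` is `FreeMonoid.of 0`, and `x̄` is `FreeMonoid.of 1`. -/
def BicyclicRel : FreeMonoid (Fin 2) → FreeMonoid (Fin 2) → Prop :=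
  fun a b => a = FreeMonoid.of 0 * FreeMonoid.of 1 ∧ b = 1

/-- The bicyclic monoid `B`: the quotient of the free monoid on two generators by the
smallest monoid congruence identifying `x·x̄` with the empty word. -/
def Bicyclic : Type := (conGen BicyclicRel).Quotient

instance : Monoid Bicyclic := inferInstanceAs (Monoid (conGen BicyclicRel).Quotient)

/-- `VA M L`: the language `L ⊆ X*` is accepted by a valence automaton over the monoid `M`,
via the standard characterization: there are a finite alphabet `Y`, a regular language
`R ⊆ Y*`, and monoid homomorphisms `φ : Y* → M`, `h : Y* → X*` with `L = h(R ∩ φ⁻¹(1))`. -/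
def VA (M : Type*) [Monoid M] {X : Type} (L : Language X) : Prop :=
  ∃ (Y : Type) (_ : Fintype Y) (R : Language Y)
    (φ : FreeMonoid Y →* M) (h : FreeMonoid Y →* FreeMonoid X),
    R.IsRegular ∧
      L = (fun w => FreeMonoid.toList (h w)) ''
            {w : FreeMonoid Y | FreeMonoid.toList w ∈ R ∧ φ w = 1}

open Classical in
/-- The Parikh image of a word: the multiset counting occurrences of each letter. -/
noncomputable def parikh {X : Type} (w : List X) : X → ℕ := fun x => w.count x

/-- A linear subset of `X^⊕`. -/
def IsLinearSet {X : Type} (S : Set (X → ℕ)) : Prop :=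
  ∃ (α₀ : X → ℕ) (n : ℕ) (α : Fin n → X → ℕ),
    S = {β | ∃ m : Fin n → ℕ, β = α₀ + ∑ i, m i • α i}

/-- A semilinear subset of `X^⊕`: a finite union of linear sets. -/
def IsSemilinearSet {X : Type} (S : Set (X → ℕ)) : Prop :=
  ∃ (n : ℕ) (T : Fin n → Set (X → ℕ)), (∀ i, IsLinearSet (T i)) ∧ S = ⋃ i, T i

/-- A language is semilinear if its Parikh image is a semilinear set. -/
def LangSemilinear {X : Type} (L : Language X) : Prop := IsSemilinearSet (parikh '' L)

theorem IsSemilinearSet.of_mathlib {X : Type} {S : Set (X → ℕ)}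
    (hS : _root_.IsSemilinearSet S) : IsSemilinearSet S := by
  obtain ⟨T, hT, hlin, rfl⟩ := hS
  obtain ⟨n, f, hf⟩ := hT.fin_embedding
  refine ⟨n, f, fun i => ?_, by rw [← hf, Set.sUnion_range]⟩
  obtain ⟨a, t, ht, hi⟩ := hlin (f i) (hf ▸ Set.mem_range_self i)
  obtain ⟨k, g, rfl⟩ := ht.fin_embedding
  refine ⟨a, k, g, ?_⟩
  rw [hi]
  ext β
  rw [Set.mem_vadd_set, Set.mem_ofPred_eq]
  constructor
  · rintro ⟨y, hy, rfl⟩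
    obtain ⟨m, rfl⟩ := AddSubmonoid.mem_closure_range_iff_of_fintype.mp hy
    exact ⟨m, rfl⟩
  · rintro ⟨m, rfl⟩
    exact ⟨_, AddSubmonoid.mem_closure_range_iff_of_fintype.mpr ⟨m, rfl⟩, rfl⟩

open scoped Pointwise in
/-- Dickson's lemma: every upper set of vectors of natural numbers is semilinear. -/
theorem isSemilinearSet_of_isUpperSet {C : Type*} [Finite C] {U : Set (C → ℕ)}
    (hU : IsUpperSet U) : _root_.IsSemilinearSet U := by
  have hfin : {m | Minimal (· ∈ U) m}.Finite :=
    WellQuasiOrderedLE.finite_of_isAntichain (setOfPred_minimal_antichain _)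
  have hUeq : U = ⋃ m ∈ {m | Minimal (· ∈ U) m}, m +ᵥ (Set.univ : Set (C → ℕ)) := by
    ext u
    simp only [Set.mem_iUnion, Set.mem_ofPred_eq, Set.mem_vadd_set, Set.mem_univ, true_and,
      exists_prop, vadd_eq_add]
    constructor
    · intro hu
      obtain ⟨m, hmu, hm⟩ := exists_minimal_le_of_wellFoundedLT (· ∈ U) u hu
      exact ⟨m, hm, u - m, add_tsub_cancel_of_le hmu⟩
    · rintro ⟨m, hm, y, rfl⟩
      exact hU (le_add_of_nonneg_right zero_le) hm.prop
  rw [hUeq]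
  exact .biUnion hfin fun m _ => .vadd m .univ

open scoped Pointwise in
/-- A pumping criterion for semilinearity: each value of `P` on `L` decomposes into one of finitely
many bases and some periods available at the argument, and the available periods can be added
without leaving `L` and without losing availability. -/
theorem isSemilinearSet_image_of_pumping {W A C : Type*} [AddCommMonoid A] [Fintype C]
    {L : Set W} {P : W → A} {p : C → A} {avail : W → Set C} {F : Set A} (hF : F.Finite)
    (pump : ∀ w ∈ L, ∀ c ∈ avail w, ∃ w' ∈ L, avail w ⊆ avail w' ∧ P w' = P w + p c)
    (decomp : ∀ w ∈ L, ∃ b ∈ F, ∃ m : C → ℕ,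
      P w = b + ∑ c, m c • p c ∧ ∀ c, m c ≠ 0 → c ∈ avail w) :
    _root_.IsSemilinearSet (P '' L) := by
  classical
  let q (D : Set C) (c : C) : A := if c ∈ D then p c else 0
  let U (D : Set C) (b : A) : Set (C → ℕ) :=
    {m | ∃ w ∈ L, D ⊆ avail w ∧ P w = b + ∑ c, m c • q D c}
  have pump_nsmul (D : Set C) (c : C) (k : ℕ) : ∀ w ∈ L, D ⊆ avail w →
      ∃ w' ∈ L, D ⊆ avail w' ∧ P w' = P w + k • q D c := by
    by_cases hc : c ∈ D
    · induction k with
      | zero => exact fun w hw hD => ⟨w, hw, hD, by simp⟩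
      | succ k ih =>
        intro w hw hD
        obtain ⟨w₁, hw₁, hD₁, h₁⟩ := ih w hw hD
        obtain ⟨w₂, hw₂, hD₂, h₂⟩ := pump w₁ hw₁ c (hD₁ hc)
        exact ⟨w₂, hw₂, hD₁.trans hD₂, by simp only [h₂, h₁, q, if_pos hc, add_assoc, succ_nsmul]⟩
    · exact fun w hw hD => ⟨w, hw, hD, by simp [q, hc]⟩
  have pump_sum (D : Set C) (k : C → ℕ) (s : Finset C) : ∀ w ∈ L, D ⊆ avail w →
      ∃ w' ∈ L, D ⊆ avail w' ∧ P w' = P w + ∑ c ∈ s, k c • q D c := by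
    induction s using Finset.induction_on with
    | empty => exact fun w hw hD => ⟨w, hw, hD, by simp⟩
    | insert c s hc ih =>
      intro w hw hD
      obtain ⟨w₁, hw₁, hD₁, h₁⟩ := ih w hw hD
      obtain ⟨w₂, hw₂, hD₂, h₂⟩ := pump_nsmul D c (k c) w₁ hw₁ hD₁
      exact ⟨w₂, hw₂, hD₂, by rw [h₂, h₁, Finset.sum_insert hc, add_assoc, add_comm (k c • _)]⟩
  have hU (D : Set C) (b : A) : IsUpperSet (U D b) := by
    rintro m n hmn ⟨w, hw, hD, h⟩
    obtain ⟨w', hw', hD', h'⟩ := pump_sum D (n - m) Finset.univ w hw hD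
    refine ⟨w', hw', hD', ?_⟩
    rw [h', h, add_assoc, ← Finset.sum_add_distrib]
    simp only [← add_nsmul, Pi.sub_apply, add_tsub_cancel_of_le (hmn _)]
  have himage : P '' L = ⋃ D : Set C, ⋃ b ∈ F,
      b +ᵥ (Fintype.linearCombination ℕ (q D) : (C → ℕ) →ₗ[ℕ] A) '' U D b := by
    ext x
    simp only [Set.mem_iUnion, Set.mem_vadd_set, Set.mem_image, exists_prop, vadd_eq_add,
      exists_exists_and_eq_and, Fintype.linearCombination_apply]
    constructor
    · rintro ⟨w, hw, rfl⟩
      obtain ⟨b, hb, m, h, hm⟩ := decomp w hw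
      have h' : P w = b + ∑ c, m c • q (avail w) c := by
        rw [h]
        congr 1
        refine Finset.sum_congr rfl fun c _ => ?_
        by_cases hc : c ∈ avail w
        · simp [q, hc]
        · simp [not_imp_comm.mp (hm c) hc]
      exact ⟨avail w, b, hb, m, ⟨w, hw, subset_rfl, h'⟩, h'.symm⟩
    · rintro ⟨D, b, hb, m, ⟨w, hw, hD, h⟩, rfl⟩
      exact ⟨w, hw, h⟩
  rw [himage]
  exact .iUnion fun D => .biUnion hF fun b _ =>
    .vadd b (.image (isSemilinearSet_of_isUpperSet (hU D b)) _)

theorem prefix_append_cases {Y : Type*} {u a c : List Y} (h : u <+: a ++ c) :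
    u <+: a ∨ ∃ t, u = a ++ t ∧ t <+: c := by
  rcases List.prefix_or_prefix_of_prefix h (List.prefix_append a c) with h' | ⟨t, rfl⟩
  · exact .inl h'
  · exact .inr ⟨t, rfl, (List.prefix_append_right_inj a).mp h⟩

/-- Every word splits, up to order, into a short word and short cycles of the automaton through
states visited by the word. -/
theorem exists_short_add_cycles {Y σ A : Type*} [AddCommMonoid A] [Fintype σ] (D : DFA Y σ)
    {P : List Y → A} (hP : ∀ u v, P (u ++ v) = P u + P v) {good : Y → Prop} {C : Type*} [Fintype C]
    (cyc : C → σ × List Y)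
    (hcyc : ∀ q v, v.length ≤ Fintype.card σ → D.evalFrom q v = q → (∀ y ∈ v, good y) →
      ∃ c, cyc c = (q, v)) (w : List Y) (hw : ∀ y ∈ w, good y) :
    ∃ w₀ : List Y, w₀.length < Fintype.card σ ∧ ∃ n : C → ℕ,
      P w = P w₀ + ∑ c, n c • P (cyc c).2 ∧
      ∀ c, n c ≠ 0 → ∃ a, a <+: w ∧ D.eval a = (cyc c).1 := by
  classical
  induction hlen : w.length using Nat.strong_induction_on generalizing w with
  | _ N ih =>
  subst hlen
  rcases lt_or_ge w.length (Fintype.card σ) with hlt | hge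
  · exact ⟨w, hlt, 0, by simp⟩
  obtain ⟨q, a, b, c, rfl, hab, hb, ha, hbq, -⟩ := D.evalFrom_split hge (s := D.start) rfl
  have hblen : 0 < b.length := List.length_pos_iff.mpr hb
  obtain ⟨d, hd⟩ := hcyc q b (by omega) hbq (fun y hy => hw y (by simp [hy]))
  obtain ⟨w₀, hw₀, n, hn, hvis⟩ := ih (a ++ c).length (by simp; omega) (a ++ c)
    (fun y hy => hw y (by simp only [List.mem_append] at hy ⊢; tauto)) rfl
  refine ⟨w₀, hw₀, n + Pi.single d 1, ?_, fun e he => ?_⟩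
  · rw [hP] at hn
    simp only [hP, Pi.add_apply, add_nsmul, Finset.sum_add_distrib, Pi.single_apply, ite_smul,
      one_nsmul, zero_nsmul, Finset.sum_ite_eq', Finset.mem_univ, if_true, hd]
    rw [← add_assoc, ← hn]
    abel
  · by_cases hed : e = d
    · subst hed
      exact ⟨a, by rw [List.append_assoc]; exact List.prefix_append _ _, by rw [hd]; exact ha⟩
    · obtain ⟨u, hu, hue⟩ := hvis e (by simpa [hed] using he)
      rcases prefix_append_cases hu with hu | ⟨t, rfl, ht⟩
      · exact ⟨u, hu.trans (by rw [List.append_assoc]; exact List.prefix_append _ _), hue⟩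
      · refine ⟨a ++ b ++ t, (List.prefix_append_right_inj _).mpr ht, ?_⟩
        rw [← hue]
        change D.evalFrom D.start _ = D.evalFrom D.start _
        rw [DFA.evalFrom_of_append, DFA.evalFrom_of_append,
          DFA.evalFrom_of_append, ha, hbq]

theorem parikh_append {X : Type} (u v : List X) : parikh (u ++ v) = parikh u + parikh v := by
  funext x
  simp [parikh]

/-- If one-sided inverses in `M` are two-sided and units of `M` are torsion, then valence automata
over `M` accept only semilinear languages. -/
theorem VA.langSemilinear {M : Type*} [Monoid M] (hM : ∀ a b : M, a * b = 1 → b * a = 1)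
    (htor : ∀ u : Mˣ, IsOfFinOrder u) {X : Type} {L : Language X} (hL : VA M L) :
    LangSemilinear L := by
  classical
  obtain ⟨Y, _, R, φ, h, ⟨σ, _, D, rfl⟩, rfl⟩ := hL
  let P (w : List Y) : X → ℕ := parikh (h (FreeMonoid.ofList w)).toList
  have hP (u v : List Y) : P (u ++ v) = P u + P v := by
    simp only [P, FreeMonoid.ofList_append, map_mul, FreeMonoid.toList_mul, parikh_append]
  let φ' (w : List Y) : M := φ (FreeMonoid.ofList w)
  have hφ (u v : List Y) : φ' (u ++ v) = φ' u * φ' v := by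
    simp only [φ', FreeMonoid.ofList_append, map_mul]
  let good (y : Y) : Prop := IsUnit (φ (FreeMonoid.of y))
  have good_of_eq_one (w : List Y) (hw : φ' w = 1) (y : Y) (hy : y ∈ w) : good y := by
    obtain ⟨s, t, rfl⟩ := List.append_of_mem hy
    have h₁ : φ' s * (φ (FreeMonoid.of y) * φ' t) = 1 := by
      rw [← hw, hφ, show y :: t = [y] ++ t from rfl, hφ]
      rfl
    have h₂ := hM _ _ h₁
    rw [mul_assoc] at h₂
    exact ⟨⟨_, _, h₂, hM _ _ h₂⟩, rfl⟩
  have exists_pow (v : List Y) (hv : ∀ y ∈ v, good y) : ∃ k, 0 < k ∧ φ' v ^ k = 1 := by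
    have hu : IsUnit (φ' v) := by
      induction v with
      | nil => simp [φ']
      | cons y v ih =>
        rw [show y :: v = [y] ++ v from rfl, hφ]
        exact (hv y (by simp)).mul (ih fun z hz => hv z (by simp [hz]))
    obtain ⟨u, hu⟩ := hu
    obtain ⟨k, hk, hk'⟩ := (htor u).exists_pow_eq_one
    exact ⟨k, hk, by rw [← hu, ← Units.val_pow_eq_pow_val, hk', Units.val_one]⟩
  let C := {c : σ × List Y // c.2.length ≤ Fintype.card σ ∧ D.evalFrom c.1 c.2 = c.1 ∧
    ∀ y ∈ c.2, good y}
  have : Finite C := by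
    refine ((Set.finite_univ.prod (List.finite_length_le Y (Fintype.card σ))).subset
      (s := Set.univ ×ˢ _) ?_ : Set.Finite _).to_subtype
    exact fun c hc => ⟨trivial, hc.1⟩
  have := Fintype.ofFinite C
  choose k hk hk' using fun c : C => exists_pow c.1.2 c.2.2.2
  let F : Set (X → ℕ) := (fun z : List Y × (C → ℕ) => P z.1 + ∑ c, z.2 c • P c.1.2) ''
    ({w | w.length ≤ Fintype.card σ} ×ˢ Set.univ.pi fun c => Set.Iio (k c))
  have hF : F.Finite :=
    ((List.finite_length_le _ _).prod (Set.Finite.pi fun c => Set.finite_Iio _)).image _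
  have key : _root_.IsSemilinearSet (P '' {w | w ∈ D.accepts ∧ φ' w = 1}) := by
    refine isSemilinearSet_image_of_pumping (p := fun c : C => k c • P c.1.2)
      (avail := fun w => {c | ∃ a, a <+: w ∧ D.eval a = c.1.1}) hF ?_ ?_
    · rintro w ⟨hwD, hw1⟩ c ⟨a, ⟨t, rfl⟩, ha⟩
      let b := (List.replicate (k c) c.1.2).flatten
      have hbD : D.evalFrom c.1.1 b = c.1.1 := by
        have (n : ℕ) : D.evalFrom c.1.1 (List.replicate n c.1.2).flatten = c.1.1 := by
          induction n with
          | zero => simp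
          | succ n ih =>
            rw [List.replicate_succ, List.flatten_cons, DFA.evalFrom_of_append, c.2.2.1, ih]
        exact this _
      have hbP : P b = k c • P c.1.2 := by
        have (n : ℕ) : P (List.replicate n c.1.2).flatten = n • P c.1.2 := by
          induction n with
          | zero => funext x; simp [P, parikh]
          | succ n ih => rw [List.replicate_succ, List.flatten_cons, hP, ih, succ_nsmul']
        exact this _
      have hbφ : φ' b = 1 := by
        have (n : ℕ) : φ' (List.replicate n c.1.2).flatten = φ' c.1.2 ^ n := by
          induction n with
          | zero => simp [φ']
          | succ n ih => rw [List.replicate_succ, List.flatten_cons, hφ, ih, pow_succ']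
        rw [← hk' c]
        exact this _
      have heval (s : List Y) : D.eval (a ++ b ++ s) = D.eval (a ++ s) := by
        change D.evalFrom D.start a = _ at ha
        change D.evalFrom D.start _ = D.evalFrom D.start _
        rw [DFA.evalFrom_of_append, DFA.evalFrom_of_append,
          DFA.evalFrom_of_append, ha, hbD]
      refine ⟨a ++ b ++ t, ⟨?_, ?_⟩, ?_, ?_⟩
      · rw [DFA.mem_accepts] at hwD ⊢
        rwa [heval]
      · rw [hφ, hφ, hbφ, mul_one, ← hφ, hw1]
      · rintro e ⟨u, hu, hue⟩
        rcases prefix_append_cases hu with hu | ⟨s, rfl, hs⟩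
        · exact ⟨u, hu.trans (by rw [List.append_assoc]; exact List.prefix_append _ _), hue⟩
        · exact ⟨a ++ b ++ s, (List.prefix_append_right_inj _).mpr hs, by rw [heval, hue]⟩
      · rw [hP, hP, hP, hbP]
        abel
    · rintro w ⟨-, hw1⟩
      obtain ⟨w₀, hw₀, n, hn, hvis⟩ := exists_short_add_cycles D hP (good := good)
        (fun c : C => c.1) (fun q v h₁ h₂ h₃ => ⟨⟨(q, v), h₁, h₂, h₃⟩, rfl⟩) w
        (good_of_eq_one w hw1)
      refine ⟨_, ⟨(w₀, fun c => n c % k c), ⟨hw₀.le, fun c _ => Nat.mod_lt _ (hk c)⟩, rfl⟩,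
        fun c => n c / k c, ?_, fun c hc => hvis c fun h0 => hc (by simp [h0])⟩
      rw [hn, add_assoc, ← Finset.sum_add_distrib]
      congr 1
      refine Finset.sum_congr rfl fun c _ => ?_
      rw [smul_smul, ← add_nsmul, mul_comm, Nat.mod_add_div]
  refine IsSemilinearSet.of_mathlib ?_
  rw [Set.image_image]
  exact key

/-- A homomorphism with trivial fibre over `1` transports acceptance by valence automata. -/
theorem VA.of_monoidHom {N M : Type*} [Monoid N] [Monoid M] (f : N →* M)
    (hf : ∀ n, f n = 1 → n = 1) {X : Type} {L : Language X} (hL : VA N L) : VA M L := by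
  obtain ⟨Y, hY, R, φ, h, hR, rfl⟩ := hL
  have hiff (w : FreeMonoid Y) : (f.comp φ) w = 1 ↔ φ w = 1 :=
    ⟨hf _, fun hw => by rw [MonoidHom.comp_apply, hw, map_one]⟩
  refine ⟨Y, hY, R, f.comp φ, h, hR, ?_⟩
  simp only [hiff]
  rfl

theorem exists_lift_eq_pow_mul_pow {N : Type*} [Monoid N] {a b : N} (hab : a * b = 1)
    (w : FreeMonoid (Fin 2)) : ∃ i j : ℕ, FreeMonoid.lift ![a, b] w = b ^ i * a ^ j := by
  induction w using FreeMonoid.inductionOn' with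
  | one => exact ⟨0, 0, by simp⟩
  | of_mul s w ih =>
    obtain ⟨i, j, h⟩ := ih
    rw [map_mul, h, FreeMonoid.lift_eval_of]
    match s with
    | 0 =>
      cases i with
      | zero => exact ⟨0, j + 1, by simp [pow_succ']⟩
      | succ i =>
        refine ⟨i, j, ?_⟩
        rw [pow_succ', mul_assoc, ← mul_assoc _ b, Matrix.cons_val_zero, hab, one_mul]
    | 1 => exact ⟨i + 1, j, by rw [pow_succ', mul_assoc]; rfl⟩

/-- The bicyclic monoid maps, with trivial fibre over `1`, to any monoid in which some one-sided
inverse is not two-sided. -/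
theorem exists_bicyclic_hom {M : Type*} [Monoid M] {a b : M} (hab : a * b = 1)
    (hba : b * a ≠ 1) : ∃ f : Bicyclic →* M, ∀ n, f n = 1 → n = 1 := by
  let c := conGen BicyclicRel
  suffices H : ∃ f : c.Quotient →* M, ∀ n, f n = 1 → n = 1 from H
  have hc : c ≤ Con.ker (FreeMonoid.lift ![a, b]) := by
    refine Con.conGen_le.mpr ?_
    rintro u v ⟨rfl, rfl⟩
    simp [Con.ker_rel, hab]
  refine ⟨c.lift (FreeMonoid.lift ![a, b]) hc, fun n => ?_⟩
  let x : c.Quotient := c.mk' (FreeMonoid.of 0)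
  let y : c.Quotient := c.mk' (FreeMonoid.of 1)
  have hxy : x * y = 1 := by
    rw [← map_mul, ← map_one c.mk']
    exact (Con.eq c).mpr (ConGen.Rel.of _ _ ⟨rfl, rfl⟩)
  obtain ⟨w, rfl⟩ := Con.mk'_surjective (c := c) n
  have hw : c.mk' w = FreeMonoid.lift ![x, y] w := by
    congr 1
    refine FreeMonoid.hom_eq fun s => ?_
    fin_cases s <;> simp [x, y]
  obtain ⟨i, j, hij⟩ := exists_lift_eq_pow_mul_pow hxy w
  intro h
  have h' : b ^ i * a ^ j = 1 := by
    rw [← h, hw, hij, map_mul, map_pow, map_pow]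
    simp [x, y]
  obtain rfl : i = 0 := by
    by_contra hi
    obtain ⟨i, rfl⟩ := Nat.exists_eq_succ_of_ne_zero hi
    rw [Nat.succ_eq_add_one, pow_succ', mul_assoc] at h'
    exact hba ((left_inv_eq_right_inv hab h') ▸ h')
  obtain rfl : j = 0 := by
    by_contra hj
    obtain ⟨j, rfl⟩ := Nat.exists_eq_succ_of_ne_zero hj
    rw [Nat.succ_eq_add_one, pow_succ, ← mul_assoc] at h'
    exact hba ((left_inv_eq_right_inv h' hab) ▸ h')
  rw [hw, hij, pow_zero, pow_zero, one_mul]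

/-- For every monoid `M`, at least one of the following holds:
(1) every language in `VA M` is semilinear; (2) every blind one-counter language
(i.e. every language in `VA ℤ`) lies in `VA M`; (3) every partially blind one-counter
language (i.e. every language in `VA B`) lies in `VA M`. -/
theorem stmt18 (M : Type*) [Monoid M] :
    (∀ (X : Type) (_ : Fintype X) (L : Language X), VA M L → LangSemilinear L) ∨
    (∀ (X : Type) (_ : Fintype X) (L : Language X), VA (Multiplicative ℤ) L → VA M L) ∨
    (∀ (X : Type) (_ : Fintype X) (L : Language X), VA Bicyclic L → VA M L) := by
  by_cases hM : ∀ a b : M, a * b = 1 → b * a = 1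
  · by_cases htor : ∀ u : Mˣ, IsOfFinOrder u
    · exact .inl fun X _ L hL => hL.langSemilinear hM htor
    · push Not at htor
      obtain ⟨u, hu⟩ := htor
      refine .inr (.inl fun X _ L hL => hL.of_monoidHom
        ((Units.coeHom M).comp (zpowersHom Mˣ u)) fun n hn => ?_)
      have hn' : u ^ n.toAdd = u ^ (0 : ℤ) := by
        rw [zpow_zero]
        exact Units.ext hn
      exact Multiplicative.toAdd.injective (injective_zpow_iff_not_isOfFinOrder.mpr hu hn')
  · push Not at hM
    obtain ⟨a, b, hab, hba⟩ := hM
    obtain ⟨f, hf⟩ := exists_bicyclic_hom hab hba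
    exact .inr (.inr fun X _ L hL => hL.of_monoidHom f hf)

end Paper
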